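/- Let p be a prime, F a finite extension of ℚ_p, and K a quadratic extension of F. Let ω_{K/F} be a multiplicative character of F^× that is nontrivial and trivial on the norm group N_{K/F}(K^×), and let f_{K/F} be the residue degree of K/F. Then for every multiplicative character χ of F^× of finite conductor, f_{K/F} · c(χ ∘ N_{K/F}) = c(χ) + c(χ·ω_{K/F}) − c(ω_{K/F}), where c(χ ∘ N_{K/F}) is the conductor of the character χ ∘ N_{K/F} of K^×. -/

import Mathlib

open scoped Classical

set_option synthInstance.maxHeartbeats 400000
set_option maxHeartbeats 1000000

noncomputable section

variable (p : ℕ) [Fact p.Prime]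

/-- The unit filtration `U_0 = O_L^×`, `U_i = 1 + 𝔭_L^i` (`i ≥ 1`) of `L^×`, where
`O_L` is the integral closure of `ℤ_p` in `L` and `𝔭_L` is its maximal ideal. -/
def unitLevelSet (L : Type*) [Field L] [Algebra ℤ_[p] L]
    [IsLocalRing (integralClosure ℤ_[p] L)] (i : ℕ) : Set Lˣ :=
  if i = 0 then
    {u : Lˣ | ∃ v : (integralClosure ℤ_[p] L)ˣ, ((v : integralClosure ℤ_[p] L) : L) = (u : L)}
  else
    {u : Lˣ | ∃ m : integralClosure ℤ_[p] L,
      m ∈ (IsLocalRing.maximalIdeal (integralClosure ℤ_[p] L)) ^ i ∧ (u : L) = 1 + (m : L)}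

variable {L : Type*} [Field L] [Algebra ℤ_[p] L] [IsLocalRing (integralClosure ℤ_[p] L)]

/-- A multiplicative character of `L^×` has finite conductor if it is trivial on `U_i`
for some `i ≥ 0`. -/
def CharHasFiniteConductor (χ : Lˣ →* ℂˣ) : Prop :=
  ∃ i : ℕ, ∀ u ∈ unitLevelSet p L i, χ u = 1

/-- The conductor `c(χ)`: the least `i ≥ 0` such that `χ` is trivial on `U_i`. -/
def charConductor (χ : Lˣ →* ℂˣ) : ℕ :=
  sInf {i : ℕ | ∀ u ∈ unitLevelSet p L i, χ u = 1}


namespace TCF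

section Grp
variable {G H M : Type*} [CommGroup G] [CommGroup H] [CommGroup M]

/-- conductor with respect to a filtration -/
noncomputable def cnd (U : ℕ → Subgroup G) (χ : G →* M) : ℕ :=
  sInf {i : ℕ | ∀ u ∈ U i, χ u = 1}

variable {U : ℕ → Subgroup G} {V : ℕ → Subgroup H}

theorem cnd_le {χ : G →* M} {i : ℕ} (h : ∀ u ∈ U i, χ u = 1) : cnd U χ ≤ i := Nat.sInf_le h

theorem cnd_spec {χ : G →* M} (h : ∃ i, ∀ u ∈ U i, χ u = 1) : ∀ u ∈ U (cnd U χ), χ u = 1 :=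
  Nat.sInf_mem (s := {i : ℕ | ∀ u ∈ U i, χ u = 1}) h

theorem cnd_eq_succ {χ : G →* M} (hU : Antitone U) {n : ℕ} (h : ∀ u ∈ U (n+1), χ u = 1)
    (h' : ¬ ∀ u ∈ U n, χ u = 1) : cnd U χ = n + 1 := by
  refine le_antisymm (cnd_le h) ?_
  by_contra! hc
  exact h' fun u hu => cnd_spec ⟨_, h⟩ u (hU (by omega) hu)

theorem cnd_succ_not {χ : G →* M} {n : ℕ} (h : cnd U χ = n + 1) : ¬ ∀ u ∈ U n, χ u = 1 := by
  intro h'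
  have := cnd_le h'
  omega

theorem down {N : H →* G} {χ : G →* M} {m k : ℕ}
    (hs : ∀ u ∈ U m, ∃ v ∈ V k, (N v)⁻¹ * u ∈ U (m+1))
    (h1 : ∀ u ∈ U (m+1), χ u = 1) (h2 : ∀ v ∈ V k, χ (N v) = 1) : ∀ u ∈ U m, χ u = 1 := by
  intro u hu
  obtain ⟨v, hv, hvu⟩ := hs u hu
  have := h1 _ hvu
  rwa [map_mul, map_inv, h2 v hv, inv_one, one_mul] at this

theorem unram_cnd (hV : Antitone V) (hU0 : U 0 = ⊤) (N : H →* G)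
    (hA : ∀ m, ∀ v ∈ V m, N v ∈ U m)
    (hB : ∀ m, ∀ u ∈ U m, ∃ v ∈ V m, (N v)⁻¹ * u ∈ U (m+1))
    (ω χ : G →* M) (hω : ∀ v, ω (N v) = 1) (hωf : ∃ i, ∀ u ∈ U i, ω u = 1)
    (hχf : ∃ i, ∀ u ∈ U i, χ u = 1) :
    2 * cnd V (χ.comp N) + cnd U ω = cnd U χ + cnd U (χ * ω) := by
  have hω1 : ω = 1 := by
    have : ∀ n, (∀ u ∈ U n, ω u = 1) → ∀ u ∈ U 0, ω u = 1 := by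
      intro n
      induction n with
      | zero => exact id
      | succ n ih => exact fun h => ih (down (hB n) h fun v _ => hω v)
    obtain ⟨i, hi⟩ := hωf
    ext1 u
    exact this i hi u (by simp [hU0])
  have h0 : cnd U ω = 0 := by
    refine Nat.le_zero.mp (cnd_le ?_)
    simp [hω1]
  have h1 : cnd V (χ.comp N) = cnd U χ := by
    rcases hn : cnd U χ with _ | n
    · refine Nat.le_zero.mp (cnd_le ?_)
      intro v hv
      exact cnd_spec hχf _ (by rw [hn]; exact hA _ _ hv)
    · have hs := cnd_spec hχf
      rw [hn] at hs
      refine cnd_eq_succ hV (fun v hv => hs _ (hA _ _ hv)) fun h => ?_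
      exact cnd_succ_not hn (down (hB n) hs h)
  rw [h0, h1, hω1, mul_one]
  omega

theorem ram_cnd (hU : Antitone U) (hV : Antitone V) (hU0 : U 0 = ⊤) (N : H →* G) (t : ℕ)
    (hA : ∀ m ≤ t + 1, ∀ v ∈ V m, N v ∈ U m)
    (hB : ∀ m < t, ∀ u ∈ U m, ∃ v ∈ V m, (N v)⁻¹ * u ∈ U (m+1))
    (hC : ∀ a ∈ U t, ∀ b ∈ U t, (∃ v ∈ V t, (N v)⁻¹ * a ∈ U (t+1)) ∨
      (∃ v ∈ V t, (N v)⁻¹ * b ∈ U (t+1)) ∨ (∃ v ∈ V t, (N v)⁻¹ * (a * b⁻¹) ∈ U (t+1)))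
    (hD : ∀ m, t < m → ∀ u ∈ U m, ∃ v ∈ V (2 * m - t), (N v)⁻¹ * u ∈ U (m+1))
    (hE : ∀ m, t < m → ∀ v ∈ V (2 * m - t + 1), N v ∈ U (m+1))
    {k : Type*} [Field k]
    (ω χ : G →* kˣ) (hω1 : ω ≠ 1) (hω : ∀ v, ω (N v) = 1) (hωf : ∃ i, ∀ u ∈ U i, ω u = 1)
    (hχf : ∃ i, ∀ u ∈ U i, χ u = 1) :
    cnd V (χ.comp N) + cnd U ω = cnd U χ + cnd U (χ * ω) := by
  have hωt : ∀ u ∈ U (t+1), ω u = 1 := by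
    have : ∀ n, (∀ u ∈ U (t+1+n), ω u = 1) → ∀ u ∈ U (t+1), ω u = 1 := by
      intro n
      induction n with
      | zero => exact id
      | succ n ih => exact fun h => ih (down (hD _ (by omega)) h fun v _ => hω v)
    obtain ⟨i, hi⟩ := hωf
    exact this i fun u hu => hi u (hU (by omega) hu)
  have hωn : ¬ ∀ u ∈ U t, ω u = 1 := by
    intro h
    have : ∀ n ≤ t, (∀ u ∈ U n, ω u = 1) → ∀ u ∈ U 0, ω u = 1 := by
      intro n
      induction n with
      | zero => exact fun _ => id
      | succ n ih => exact fun hn h => ih (by omega) (down (hB n (by omega)) h fun v _ => hω v)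
    apply hω1
    ext1 u
    exact this t le_rfl h u (by simp [hU0])
  have hcω : cnd U ω = t + 1 := cnd_eq_succ hU hωt hωn
  have caseB : ∀ ψ : G →* kˣ, (∃ i, ∀ u ∈ U i, ψ u = 1) → cnd U ψ ≤ t →
      cnd V (ψ.comp N) = cnd U ψ := by
    intro ψ hψ hle
    rcases hn : cnd U ψ with _ | n
    · refine Nat.le_zero.mp (cnd_le ?_)
      intro v hv
      exact cnd_spec hψ _ (by rw [hn]; exact hA _ (by omega) _ hv)
    · have hs := cnd_spec hψ
      rw [hn] at hs
      refine cnd_eq_succ hV (fun v hv => hs _ (hA _ (by omega) _ hv)) fun h => ?_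
      exact cnd_succ_not hn (down (hB n (by omega)) hs h)
  have hs := cnd_spec hχf
  rcases lt_trichotomy (cnd U χ) (t+1) with hlt | heq | hgt
  · rw [caseB χ hχf (by omega), hcω]
    congr 1
    symm
    have ht : ∀ u ∈ U t, χ u = 1 := fun u hu => hs u (hU (by omega) hu)
    refine cnd_eq_succ hU (fun u hu => ?_) fun h => hωn fun u hu => ?_
    · rw [MonoidHom.mul_apply, hωt u hu, ht u (hU (by omega) hu), one_mul]
    · have := h u hu
      rwa [MonoidHom.mul_apply, ht u hu, one_mul] at this
  · rw [heq] at hs ⊢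
    have hs' : ∀ u ∈ U (t+1), (χ * ω) u = 1 := fun u hu => by
      rw [MonoidHom.mul_apply, hωt u hu, hs u hu, one_mul]
    have hcN : (χ * ω).comp N = χ.comp N := by
      ext1 v
      simp [hω v]
    rcases Nat.lt_or_ge t (cnd U (χ * ω)) with h | h
    · have heq' : cnd U (χ * ω) = t + 1 := le_antisymm (cnd_le hs') h
      rw [heq', hcω]
      congr 1
      refine cnd_eq_succ hV (fun v hv => hs _ (hA _ le_rfl _ hv)) fun hh => ?_
      have h1 := cnd_succ_not heq
      have h2 := cnd_succ_not heq'
      push Not at h1 h2 hωn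
      obtain ⟨u, hu, hu1⟩ := h1
      obtain ⟨u', hu', hu1'⟩ := h2
      obtain ⟨w, hw, hw1⟩ := hωn
      have key : ∀ a, (∃ v ∈ V t, (N v)⁻¹ * a ∈ U (t+1)) → χ a = 1 ∧ ω a = 1 := by
        rintro a ⟨v, hv, hva⟩
        have e1 := hs _ hva
        have e2 := hωt _ hva
        rw [map_mul, map_inv, hω v, inv_one, one_mul] at e2
        have e3 : χ (N v) = 1 := hh v hv
        rw [map_mul, map_inv, e3, inv_one, one_mul] at e1
        exact ⟨e1, e2⟩
      have hww : χ (w * w) = 1 ∧ ω (w * w) = 1 := by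
        rcases hC w hw w⁻¹ (inv_mem hw) with h | h | h
        · exact absurd (key _ h).2 hw1
        · have := (key _ h).2
          rw [map_inv, inv_eq_one] at this
          exact absurd this hw1
        · rw [inv_inv] at h
          exact key _ h
      have huw : χ (u * w⁻¹) = 1 := by
        rcases hC u hu w hw with h | h | h
        · exact absurd (key _ h).1 hu1
        · exact absurd (key _ h).2 hw1
        · exact (key _ h).1
      have huw' : χ (u' * w⁻¹) = 1 ∧ ω (u' * w⁻¹) = 1 := by
        rcases hC u' hu' w hw with h | h | h
        · exact absurd (by rw [MonoidHom.mul_apply, (key _ h).1, (key _ h).2, one_mul]) hu1'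
        · exact absurd (key _ h).2 hw1
        · exact (key _ h)
      simp only [map_mul, map_inv, mul_inv_eq_one] at huw huw' hww
      rw [MonoidHom.mul_apply, huw'.1, huw'.2] at hu1'
      rw [huw] at hu1
      have sq : ∀ x : kˣ, x * x = 1 → x ≠ 1 → x = -1 := by
        intro x hx hx1
        have : (x : k) * x = 1 := by rw [← Units.val_mul, hx, Units.val_one]
        rcases mul_self_eq_one_iff.mp this with h | h
        · exact absurd (Units.ext h) hx1
        · exact Units.ext (by simpa using h)
      rw [sq _ hww.1 hu1, sq _ hww.2 hw1] at hu1'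
      exact hu1' (by simp)
    · have := caseB (χ * ω) ⟨_, hs'⟩ h
      rw [hcN] at this
      omega
  · obtain ⟨m, hm⟩ : ∃ m, cnd U χ = m + 1 := ⟨cnd U χ - 1, by omega⟩
    have htm : t < m := by omega
    rw [hm] at hs
    have hn := cnd_succ_not hm
    have hωm : ∀ u ∈ U m, ω u = 1 := fun u hu => hωt u (hU (by omega) hu)
    have e1 : cnd U (χ * ω) = m + 1 := by
      refine cnd_eq_succ hU (fun u hu => ?_) fun h => hn fun u hu => ?_
      · rw [MonoidHom.mul_apply, hs u hu, hωm u (hU (by omega) hu), one_mul]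
      · have := h u hu
        rwa [MonoidHom.mul_apply, hωm u hu, mul_one] at this
    have e2 : cnd V (χ.comp N) = 2 * m - t + 1 :=
      cnd_eq_succ hV (fun v hv => hs _ (hE m htm v hv)) fun h => hn (down (hD m htm) hs h)
    omega

theorem index_two_aux [Finite G] (φ : G →* G) (h : Nat.card φ.ker ≤ 2) (a b : G) :
    a ∈ φ.range ∨ b ∈ φ.range ∨ a * b⁻¹ ∈ φ.range := by
  have h1 : φ.range.index = Nat.card φ.ker := by
    have e1 := φ.range.card_mul_index
    have e2 := φ.ker.card_mul_index
    rw [Subgroup.index_ker] at e2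
    have : 0 < Nat.card φ.range := Nat.card_pos
    rw [← e2, mul_comm] at e1
    exact Nat.eq_of_mul_eq_mul_right this e1
  have h0 : φ.range.index ≠ 0 := Subgroup.FiniteIndex.index_ne_zero
  have : φ.range.index = 1 ∨ φ.range.index = 2 := by omega
  rcases this with h | h
  · left
    rw [Subgroup.index_eq_one.mp h]; trivial
  · by_cases ha : a ∈ φ.range
    · exact Or.inl ha
    by_cases hb : b ∈ φ.range
    · exact Or.inr (Or.inl hb)
    right; right
    rw [Subgroup.mul_mem_iff_of_index_two h]
    simp [ha, hb]

end Grp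
end TCF

namespace TCF
section Rng
set_option linter.unusedSectionVars false

/-- unit filtration as subgroups -/
def UL (R : Type*) [CommRing R] [IsLocalRing R] (i : ℕ) : Subgroup Rˣ where
  carrier := {u | (u : R) - 1 ∈ (IsLocalRing.maximalIdeal R) ^ i}
  one_mem' := by simp
  mul_mem' := by
    intro a b ha hb
    simp only [Set.mem_ofPred_eq, Units.val_mul] at *
    have : (a : R) * b - 1 = a * (b - 1) + (a - 1) := by ring
    rw [this]
    exact add_mem (Ideal.mul_mem_left _ _ hb) ha
  inv_mem' := by
    intro a ha
    simp only [Set.mem_ofPred_eq] at *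
    have : ((a⁻¹ : Rˣ) : R) - 1 = -((a⁻¹ : Rˣ) : R) * (a - 1) := by
      rw [mul_sub, neg_mul, Units.inv_mul]; ring
    rw [this]
    exact Ideal.mul_mem_left _ _ ha

theorem mem_UL {R : Type*} [CommRing R] [IsLocalRing R] {i : ℕ} {u : Rˣ} :
    u ∈ UL R i ↔ (u : R) - 1 ∈ (IsLocalRing.maximalIdeal R) ^ i := Iff.rfl

theorem UL_antitone (R : Type*) [CommRing R] [IsLocalRing R] : Antitone (UL R) :=
  fun _ _ h _ hu => Ideal.pow_le_pow_right h hu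

theorem UL_zero (R : Type*) [CommRing R] [IsLocalRing R] : UL R 0 = ⊤ := by
  ext u; simp [mem_UL]

theorem inv_mul_mem_UL {R : Type*} [CommRing R] [IsLocalRing R] {i : ℕ} {u v : Rˣ}
    (h : (u : R) - v ∈ (IsLocalRing.maximalIdeal R) ^ i) : v⁻¹ * u ∈ UL R i := by
  rw [mem_UL]
  have : ((v⁻¹ * u : Rˣ) : R) - 1 = ((v⁻¹ : Rˣ) : R) * (u - v) := by
    rw [mul_sub, Units.inv_mul, Units.val_mul]
  rw [this]
  exact Ideal.mul_mem_left _ _ h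

variable {A B : Type*} [CommRing A] [CommRing B] [Algebra A B] [Module.Free A B]
  [Module.Finite A B]

theorem norm_one_add [Nontrivial A] (h2 : Module.finrank A B = 2) (x : B) :
    Algebra.norm A (1 + x) = 1 + Algebra.trace A B x + Algebra.norm A x := by
  let b := Module.finBasisOfFinrankEq A B h2
  rw [Algebra.norm_eq_matrix_det b, Algebra.norm_eq_matrix_det b, Algebra.trace_eq_matrix_trace b,
    map_add, map_one, Matrix.det_fin_two, Matrix.det_fin_two, Matrix.trace_fin_two]
  simp
  ring

theorem quad_eq [Nontrivial A] (h2 : Module.finrank A B = 2) (x : B) :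
    x * x = algebraMap A B (Algebra.trace A B x) * x - algebraMap A B (Algebra.norm A x) := by
  let b := Module.finBasisOfFinrankEq A B h2
  apply Algebra.leftMulMatrix_injective b
  rw [Algebra.norm_eq_matrix_det b, Algebra.trace_eq_matrix_trace b]
  rw [map_sub, map_mul, map_mul, AlgHom.commutes, AlgHom.commutes, Matrix.det_fin_two,
    Matrix.trace_fin_two]
  generalize Algebra.leftMulMatrix b x = m
  ext i j
  fin_cases i <;> fin_cases j <;>
    simp [Matrix.mul_apply, Fin.sum_univ_two, Matrix.algebraMap_matrix_apply] <;> ring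

theorem norm_alg [Nontrivial A] (h2 : Module.finrank A B = 2) (a : A) :
    Algebra.norm A (algebraMap A B a) = a ^ 2 := by
  rw [Algebra.norm_algebraMap_of_basis (Module.Free.chooseBasis A B),
    ← Module.finrank_eq_card_chooseBasisIndex, h2]

theorem trace_mul (a : A) (x : B) :
    Algebra.trace A B (algebraMap A B a * x) = a * Algebra.trace A B x := by
  rw [← Algebra.smul_def, map_smul, smul_eq_mul]

theorem norm_mul' [Nontrivial A] (h2 : Module.finrank A B = 2) (a : A) (x : B) :
    Algebra.norm A (algebraMap A B a * x) = a ^ 2 * Algebra.norm A x := by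
  rw [map_mul, norm_alg h2]

theorem trace_one' [Nontrivial A] (h2 : Module.finrank A B = 2) :
    Algebra.trace A B 1 = 2 := by
  have := Algebra.trace_algebraMap_of_basis (Module.Free.chooseBasis A B) (1 : A)
  rw [← Module.finrank_eq_card_chooseBasisIndex, h2] at this
  simpa using this

theorem norm_quotient_mk [IsLocalRing A] (x : B) :
    Algebra.norm (A ⧸ IsLocalRing.maximalIdeal A)
      (Ideal.Quotient.mk (Ideal.map (algebraMap A B) (IsLocalRing.maximalIdeal A)) x) =
      Ideal.Quotient.mk _ (Algebra.norm A x) := by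
  let ι := Module.Free.ChooseBasisIndex A B
  let b : Module.Basis ι A B := Module.Free.chooseBasis A B
  classical
  let := Ideal.Quotient.field (IsLocalRing.maximalIdeal A)
  rw [Algebra.norm_eq_matrix_det b, Algebra.norm_eq_matrix_det (IsLocalRing.basisQuotient b),
    RingHom.map_det]
  congr 1
  ext i j
  simp only [Algebra.leftMulMatrix_apply, Algebra.coe_lmul_eq_mul, LinearMap.toMatrix_apply,
    IsLocalRing.basisQuotient_apply, LinearMap.mul_apply', Matrix.map_apply, ← map_mul,
    IsLocalRing.basisQuotient_repr, RingHom.mapMatrix_apply]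

variable [IsDomain A] [IsDomain B] [IsDiscreteValuationRing A] [IsDiscreteValuationRing B]

theorem mem_pow_iff {R : Type*} [CommRing R] [IsDomain R] [IsDiscreteValuationRing R] {ϖ : R}
    (hϖ : Irreducible ϖ) (m : ℕ) (x : R) :
    x ∈ (IsLocalRing.maximalIdeal R) ^ m ↔ ϖ ^ m ∣ x := by
  rw [hϖ.maximalIdeal_eq, Ideal.span_singleton_pow, Ideal.mem_span_singleton]

theorem isUnit_one_add {R : Type*} [CommRing R] [IsDomain R] [IsDiscreteValuationRing R] {ϖ : R}
    (hϖ : Irreducible ϖ) {m : ℕ} (hm : m ≠ 0) {x : R} (hx : ϖ ^ m ∣ x) : IsUnit (1 + x) := by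
  have : x ∈ IsLocalRing.maximalIdeal R := by
    rw [hϖ.maximalIdeal_eq, Ideal.mem_span_singleton]
    exact (dvd_pow_self _ hm).trans hx
  by_contra h
  have h1 : (1 : R) = (1 + x) - x := by ring
  have h2 : (1 : R) ∈ IsLocalRing.maximalIdeal R := by
    rw [h1]; exact sub_mem ((IsLocalRing.mem_maximalIdeal _).2 h) this
  exact (IsLocalRing.mem_maximalIdeal _).1 h2 isUnit_one

theorem isUnit_alg_irr (h2 : Module.finrank A B = 2) {a : A} (ha : IsUnit (algebraMap A B a)) :
    IsUnit a := by
  have := ha.map (Algebra.norm A)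
  rw [norm_alg h2] at this
  exact (isUnit_pow_iff two_ne_zero).1 this

/-- norm on units -/
noncomputable def NU (A B : Type*) [CommRing A] [CommRing B] [Algebra A B] : Bˣ →* Aˣ :=
  Units.map (Algebra.norm A (S := B))

theorem NU_coe (v : Bˣ) : ((NU A B v : Aˣ) : A) = Algebra.norm A (v : B) := rfl

theorem unram_main (h2 : Module.finrank A B = 2) [Finite (IsLocalRing.ResidueField A)]
    {ϖ : A} (hϖ : Irreducible ϖ) (hϖB : Irreducible (algebraMap A B ϖ)) {M : Type*} [CommGroup M]
    (ω χ : Aˣ →* M) (hω : ∀ v, ω (NU A B v) = 1) (hωf : ∃ i, ∀ u ∈ UL A i, ω u = 1)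
    (hχf : ∃ i, ∀ u ∈ UL A i, χ u = 1) :
    2 * cnd (UL B) (χ.comp (NU A B)) + cnd (UL A) ω = cnd (UL A) χ + cnd (UL A) (χ * ω) := by
  have hPB : Ideal.map (algebraMap A B) (IsLocalRing.maximalIdeal A) =
      IsLocalRing.maximalIdeal B := by
    rw [hϖ.maximalIdeal_eq, Ideal.map_span, hϖB.maximalIdeal_eq, Set.image_singleton]
  have hmax : (Ideal.map (algebraMap A B) (IsLocalRing.maximalIdeal A)).IsMaximal := by
    rw [hPB]; infer_instance
  let i1 := Ideal.Quotient.field (IsLocalRing.maximalIdeal A)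
  let i2 := Ideal.Quotient.field (Ideal.map (algebraMap A B) (IsLocalRing.maximalIdeal A))
  have : Finite (A ⧸ IsLocalRing.maximalIdeal A) :=
    inferInstanceAs (Finite (IsLocalRing.ResidueField A))
  have : Module.Finite (A ⧸ IsLocalRing.maximalIdeal A)
      (B ⧸ (Ideal.map (algebraMap A B) (IsLocalRing.maximalIdeal A))) :=
    Module.Finite.of_basis (IsLocalRing.basisQuotient (Module.Free.chooseBasis A B))
  have : Finite (B ⧸ (Ideal.map (algebraMap A B) (IsLocalRing.maximalIdeal A))) :=
    Module.finite_of_finite (A ⧸ IsLocalRing.maximalIdeal A)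
  refine unram_cnd (UL_antitone B) (UL_zero A) (NU A B) ?_ ?_ ω χ hω hωf hχf
  · intro m v hv
    rw [mem_UL, mem_pow_iff hϖB, ← map_pow] at hv
    rw [mem_UL, mem_pow_iff hϖ, NU_coe]
    obtain ⟨x, hx⟩ := hv
    have : (v : B) = 1 + algebraMap A B (ϖ ^ m) * x := by rw [← hx]; ring
    rw [this, norm_one_add h2, trace_mul, norm_mul' h2]
    exact ⟨Algebra.trace A B x + ϖ ^ m * Algebra.norm A x, by ring⟩
  · intro m u hu
    rcases Nat.eq_zero_or_pos m with rfl | hm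
    · obtain ⟨y, hy⟩ := FiniteField.norm_surjective (A ⧸ IsLocalRing.maximalIdeal A)
        (B ⧸ (Ideal.map (algebraMap A B) (IsLocalRing.maximalIdeal A)))
        (Ideal.Quotient.mk _ (u : A))
      obtain ⟨x, rfl⟩ := Ideal.Quotient.mk_surjective y
      rw [norm_quotient_mk] at hy
      have hxu : IsUnit x := by
        by_contra h
        have hx : x ∈ Ideal.map (algebraMap A B) (IsLocalRing.maximalIdeal A) := by
          rw [hPB]; exact h
        have : Ideal.Quotient.mk (IsLocalRing.maximalIdeal A) (Algebra.norm A x) = 0 := by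
          rw [← norm_quotient_mk, Ideal.Quotient.eq_zero_iff_mem.2 hx, Algebra.norm_zero]
        rw [hy, Ideal.Quotient.eq_zero_iff_mem] at this
        exact (IsLocalRing.mem_maximalIdeal _).1 this u.isUnit
      obtain ⟨v, rfl⟩ := hxu
      refine ⟨v, by rw [UL_zero]; trivial, inv_mul_mem_UL ?_⟩
      rw [zero_add, pow_one, NU_coe]
      exact Ideal.Quotient.eq.1 hy.symm
    · have htr : ∃ x, Algebra.trace A B x = 1 := by
        obtain ⟨y, hy⟩ := Algebra.trace_surjective (A ⧸ IsLocalRing.maximalIdeal A)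
          (B ⧸ (Ideal.map (algebraMap A B) (IsLocalRing.maximalIdeal A))) 1
        obtain ⟨x, rfl⟩ := Ideal.Quotient.mk_surjective y
        rw [Algebra.trace_quotient_mk] at hy
        have hu : IsUnit (Algebra.trace A B x) := by
          by_contra h
          have := Ideal.Quotient.eq_zero_iff_mem.2 ((IsLocalRing.mem_maximalIdeal _).2 h)
          rw [hy] at this
          exact one_ne_zero this
        obtain ⟨w, hw⟩ := hu
        refine ⟨algebraMap A B ((w⁻¹ : Aˣ) : A) * x, ?_⟩
        rw [trace_mul, ← hw, Units.inv_mul]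
      obtain ⟨x, hx⟩ := htr
      rw [mem_UL, mem_pow_iff hϖ] at hu
      obtain ⟨a, ha⟩ := hu
      have hun := isUnit_one_add hϖB hm.ne' (x := algebraMap A B (ϖ ^ m * a) * x)
        ⟨algebraMap A B a * x, by rw [map_mul, map_pow, mul_assoc]⟩
      obtain ⟨v, hv⟩ := hun
      refine ⟨v, ?_, inv_mul_mem_UL ?_⟩
      · rw [mem_UL, mem_pow_iff hϖB, hv]
        exact ⟨algebraMap A B a * x, by rw [map_mul, map_pow]; ring⟩
      · rw [mem_pow_iff hϖ, NU_coe, hv, norm_one_add h2, trace_mul, norm_mul' h2, hx]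
        obtain ⟨n, rfl⟩ : ∃ n, m = n + 1 := ⟨m - 1, by omega⟩
        refine ⟨- (ϖ ^ n * a ^ 2 * Algebra.norm A x), ?_⟩
        rw [show (u : A) = 1 + ϖ ^ (n + 1) * a by rw [← ha]; ring]
        ring

end Rng
end TCF

namespace TCF
section Ram
set_option linter.unusedSectionVars false
variable {A B : Type*} [CommRing A] [CommRing B] [Algebra A B] [Module.Free A B]
  [Module.Finite A B]
variable [IsDomain A] [IsDomain B] [IsDiscreteValuationRing A] [IsDiscreteValuationRing B]

theorem norm_unif (h2 : Module.finrank A B = 2) {ϖ : A} (hϖ : Irreducible ϖ) {π : B} {w : Bˣ}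
    (hw : algebraMap A B ϖ = w * π ^ 2) : ∃ ν : Aˣ, Algebra.norm A π = ϖ * ν := by
  have h := norm_alg (B := B) h2 ϖ
  rw [hw, map_mul, map_pow] at h
  have hd : ϖ ∣ Algebra.norm A (w : B) * Algebra.norm A π ^ 2 := by
    rw [h]; exact dvd_pow_self _ two_ne_zero
  have hwu : IsUnit (Algebra.norm A (w : B)) := w.isUnit.map _
  have hd2 : ϖ ∣ Algebra.norm A π := by
    rcases hϖ.prime.dvd_or_dvd hd with h' | h'
    · exact absurd (isUnit_of_dvd_unit h' hwu) hϖ.not_isUnit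
    · exact hϖ.prime.dvd_of_dvd_pow h'
  obtain ⟨c, hc⟩ := hd2
  rw [hc] at h
  have h3 : c * (Algebra.norm A (w : B) * c) = 1 := by
    have : ϖ ^ 2 * (c * (Algebra.norm A (w : B) * c)) = ϖ ^ 2 * 1 := by linear_combination h
    exact mul_left_cancel₀ (pow_ne_zero _ hϖ.ne_zero) this
  exact ⟨Units.mkOfMulEqOne _ _ h3, hc⟩

theorem pow_dvd_norm {ϖ : A} {π : B} {ν : Aˣ} (hν : Algebra.norm A π = ϖ * ν) {m : ℕ} {x : B}
    (hx : π ^ m ∣ x) : ϖ ^ m ∣ Algebra.norm A x := by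
  obtain ⟨y, rfl⟩ := hx
  rw [map_mul, map_pow, hν, mul_pow, mul_assoc]
  exact dvd_mul_right _ _

theorem pow_two_dvd {ϖ : A} {π : B} (hπ : Irreducible π) {w : Bˣ}
    (hw : algebraMap A B ϖ = w * π ^ 2) {k : ℕ} {x : B} (hx : π ^ (k + 2) ∣ x) :
    ∃ y, x = algebraMap A B ϖ * y ∧ π ^ k ∣ y := by
  obtain ⟨z, rfl⟩ := hx
  refine ⟨π ^ k * (((w⁻¹ : Bˣ) : B) * z), ?_, dvd_mul_right _ _⟩
  rw [hw]
  have : (w : B) * ((w⁻¹ : Bˣ) : B) = 1 := w.mul_inv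
  linear_combination (-π ^ (k+2) * z) * this

theorem trace_exp (h2 : Module.finrank A B = 2) (h20 : (2 : A) ≠ 0) {ϖ : A} (hϖ : Irreducible ϖ)
    {π : B} (hπ : Irreducible π) {w : Bˣ} (hw : algebraMap A B ϖ = w * π ^ 2) (k : ℕ) :
    ∃ T : ℕ, (∀ x, π ^ k ∣ x → ϖ ^ T ∣ Algebra.trace A B x) ∧
      ∃ x, π ^ k ∣ x ∧ Algebra.trace A B x = ϖ ^ T := by
  let I : Ideal A := Submodule.map (Algebra.trace A B)
    ((Ideal.span {π ^ k} : Ideal B).restrictScalars A)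
  have hI : I ≠ ⊥ := by
    intro h
    have : Algebra.trace A B (algebraMap A B (ϖ ^ k)) ∈ I := by
      refine ⟨_, ?_, rfl⟩
      simp only [SetLike.mem_coe, Submodule.restrictScalars_mem, Ideal.mem_span_singleton]
      rw [map_pow, hw, mul_pow, ← pow_mul, two_mul, pow_add]
      exact ⟨w ^ k * π ^ k, by ring⟩
    rw [h, Ideal.mem_bot, ← mul_one (algebraMap A B (ϖ ^ k)), trace_mul, trace_one' h2] at this
    exact (mul_ne_zero (pow_ne_zero _ hϖ.ne_zero) h20) this
  obtain ⟨T, hT⟩ := IsDiscreteValuationRing.ideal_eq_span_pow_irreducible hI hϖ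
  refine ⟨T, fun x hx => ?_, ?_⟩
  · rw [← Ideal.mem_span_singleton, ← hT]
    exact ⟨x, by simpa [Ideal.mem_span_singleton] using hx, rfl⟩
  · have : ϖ ^ T ∈ I := by rw [hT]; exact Ideal.mem_span_singleton_self _
    obtain ⟨x, hx, hx'⟩ := this
    exact ⟨x, by simpa [Ideal.mem_span_singleton] using hx, hx'⟩

theorem trace_exp_formula (h2 : Module.finrank A B = 2) (h20 : (2 : A) ≠ 0) {ϖ : A}
    (hϖ : Irreducible ϖ)
    {π : B} (hπ : Irreducible π) {w : Bˣ} (hw : algebraMap A B ϖ = w * π ^ 2) :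
    ∃ t : ℕ, ∀ k, (∀ x, π ^ k ∣ x → ϖ ^ ((k + t + 1) / 2) ∣ Algebra.trace A B x) ∧
      ∃ x, π ^ k ∣ x ∧ Algebra.trace A B x = ϖ ^ ((k + t + 1) / 2) := by
  choose T hT1 hT2 using trace_exp h2 h20 hϖ hπ hw
  have hle : ∀ {a b : ℕ}, ϖ ^ a ∣ ϖ ^ b → a ≤ b := fun h =>
    (pow_dvd_pow_iff hϖ.ne_zero hϖ.not_isUnit).1 h
  have hmono : ∀ k, T k ≤ T (k + 1) := by
    intro k
    obtain ⟨x, hx, hx'⟩ := hT2 (k + 1)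
    have := hT1 k x ((pow_dvd_pow _ (Nat.le_succ k)).trans hx)
    rw [hx'] at this
    exact hle this
  have hstep : ∀ k, T (k + 2) = T k + 1 := by
    intro k
    apply le_antisymm
    · obtain ⟨x, hx, hx'⟩ := hT2 k
      have := hT1 (k + 2) (algebraMap A B ϖ * x) (by
        obtain ⟨y, rfl⟩ := hx
        rw [hw]
        exact ⟨w * y, by ring⟩)
      rw [trace_mul, hx', mul_comm, ← pow_succ] at this
      exact hle this
    · obtain ⟨x, hx, hx'⟩ := hT2 (k + 2)
      obtain ⟨y, rfl, hy⟩ := pow_two_dvd hπ hw hx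
      have := mul_dvd_mul_left ϖ (hT1 k y hy)
      rw [trace_mul] at hx'
      rw [hx', mul_comm, ← pow_succ] at this
      exact hle this
  obtain ⟨ν, hν⟩ := norm_unif h2 hϖ hw
  have hT1pos : 1 ≤ T 1 := by
    obtain ⟨x, hx, hx'⟩ := hT2 1
    rw [pow_one] at hx
    by_contra! hlt
    have h0 : T 1 = 0 := by omega
    rw [h0, pow_zero] at hx'
    have hq := quad_eq h2 x
    rw [hx', map_one, one_mul] at hq
    obtain ⟨c, hc⟩ := pow_dvd_norm hν (m := 1) (x := x) (by simpa using hx)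
    obtain ⟨y, hy⟩ := hx
    have hx2 : π ^ (0 + 2) ∣ x := by
      have : x = x * x + algebraMap A B (Algebra.norm A x) := by rw [hq]; ring
      rw [this, hc, pow_one, map_mul, hw, hy]
      exact ⟨y * y + w * algebraMap A B c, by ring⟩
    obtain ⟨y, rfl, -⟩ := pow_two_dvd hπ hw hx2
    rw [trace_mul] at hx'
    exact hϖ.not_isUnit (IsUnit.of_mul_eq_one _ hx')
  have m0 := hmono 0
  have m1 := hmono 1
  have s0 := hstep 0
  simp only [zero_add] at m0 m1 s0
  norm_num at m1
  have : ∃ t, T 0 = (t + 1) / 2 ∧ T 1 = (t + 2) / 2 := by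
    by_cases h : T 0 = T 1
    · exact ⟨2 * T 0 - 1, by omega, by omega⟩
    · exact ⟨2 * T 0, by omega, by omega⟩
  obtain ⟨t, ht0, ht1⟩ := this
  have hT : ∀ k, T k = (k + t + 1) / 2 := by
    intro k
    induction k using Nat.strong_induction_on with
    | _ k ih =>
      match k, ih with
      | 0, _ => rw [ht0]; congr 1; omega
      | 1, _ => rw [ht1]; congr 1; omega
      | k + 2, ih =>
        rw [hstep, ih k (by omega)]
        omega
  refine ⟨t, fun k => ?_⟩
  rw [← hT k]
  exact ⟨hT1 k, hT2 k⟩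

/-- lifting residue identities -/
theorem res_dvd {ϖ : A} (hϖ : Irreducible ϖ) {x y : A}
    (h : IsLocalRing.residue A x = IsLocalRing.residue A y) : ϖ ∣ x - y := by
  rw [← Ideal.mem_span_singleton, ← hϖ.maximalIdeal_eq]
  exact Ideal.Quotient.eq.1 h

theorem ram_main (h2 : Module.finrank A B = 2) (h20 : (2 : A) ≠ 0)
    [Finite (IsLocalRing.ResidueField A)]
    {ϖ : A} (hϖ : Irreducible ϖ) {π : B} (hπ : Irreducible π) {w : Bˣ}
    (hw : algebraMap A B ϖ = w * π ^ 2)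
    {k : Type*} [Field k]
    (ω χ : Aˣ →* kˣ) (hω1 : ω ≠ 1) (hω : ∀ v, ω (NU A B v) = 1)
    (hωf : ∃ i, ∀ u ∈ UL A i, ω u = 1)
    (hχf : ∃ i, ∀ u ∈ UL A i, χ u = 1) :
    cnd (UL B) (χ.comp (NU A B)) + cnd (UL A) ω = cnd (UL A) χ + cnd (UL A) (χ * ω) := by
  obtain ⟨t, ht⟩ := trace_exp_formula h2 h20 hϖ hπ hw
  obtain ⟨ν, hν⟩ := norm_unif h2 hϖ hw
  have hNsub : ∀ i m, m ≤ i → m ≤ (i + t + 1) / 2 → ∀ v ∈ UL B i, NU A B v ∈ UL A m := by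
    intro i m h h' v hv
    rw [mem_UL, mem_pow_iff hπ] at hv
    rw [mem_UL, mem_pow_iff hϖ, NU_coe]
    have : (v : B) = 1 + (v - 1) := by ring
    rw [this, norm_one_add h2]
    have e : ∀ a b : A, 1 + a + b - 1 = a + b := fun a b => by ring
    rw [e]
    exact dvd_add ((pow_dvd_pow _ h').trans ((ht i).1 _ hv))
      ((pow_dvd_pow _ h).trans (pow_dvd_norm hν hv))
  -- norm of one plus c times a power of the uniformizer
  have hNf : ∀ (c : A) (m : ℕ), Algebra.norm A (1 + algebraMap A B c * π ^ m) =
      1 + c * Algebra.trace A B (π ^ m) + c ^ 2 * (ϖ ^ m * (ν : A) ^ m) := by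
    intro c m
    rw [norm_one_add h2, trace_mul, norm_mul' h2, map_pow (Algebra.norm A), hν, mul_pow]
  have hchar : 0 < t → IsLocalRing.residue A 2 = 0 := by
    intro h
    have := (ht 0).1 1 (by simp)
    rw [trace_one' h2] at this
    have h' : ϖ ∣ 2 := (dvd_pow_self ϖ (by omega)).trans this
    rw [IsLocalRing.residue_eq_zero_iff, hϖ.maximalIdeal_eq, Ideal.mem_span_singleton]
    exact h'
  have hmul : ∀ (c : A) (m : ℕ), 0 < m → ∃ v : Bˣ, v ∈ UL B m ∧
      (v : B) = 1 + algebraMap A B c * π ^ m := by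
    intro c m hm
    obtain ⟨v, hv⟩ := isUnit_one_add hπ hm.ne' (x := algebraMap A B c * π ^ m)
      (dvd_mul_left _ _)
    refine ⟨v, ?_, hv⟩
    rw [mem_UL, mem_pow_iff hπ, hv]
    exact ⟨algebraMap A B c, by ring⟩
  have hunit : ∀ c : A, IsLocalRing.residue A c ≠ 0 → IsUnit c := by
    intro c hc
    by_contra h
    exact hc ((IsLocalRing.residue_eq_zero_iff _).2 h)
  have hsq : ∀ (u : Aˣ) (c : A), IsLocalRing.residue A c ^ 2 = IsLocalRing.residue A u →
      ∃ v ∈ UL B 0, (NU A B v)⁻¹ * u ∈ UL A (0 + 1) := by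
    intro u c hc
    have hcu : IsUnit c := by
      apply hunit
      rintro h0
      rw [h0] at hc
      have : IsLocalRing.residue A (u : A) ≠ 0 := by
        rw [Ne, IsLocalRing.residue_eq_zero_iff]
        exact fun h => h u.isUnit
      exact this (by rw [← hc]; simp)
    obtain ⟨c, rfl⟩ := hcu
    refine ⟨Units.map (algebraMap A B : A →* B) c, by rw [UL_zero]; trivial, inv_mul_mem_UL ?_⟩
    rw [mem_pow_iff hϖ, NU_coe, zero_add, pow_one]
    apply res_dvd hϖ
    rw [← hc]
    simp [norm_alg h2]
  refine ram_cnd (UL_antitone A) (UL_antitone B) (UL_zero A) (NU A B) t ?_ ?_ ?_ ?_ ?_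
    ω χ hω1 hω hωf hχf
  · intro m hm
    exact hNsub m m le_rfl (by omega)
  · intro m hm u hu
    have hc2 : CharP (IsLocalRing.ResidueField A) 2 := by
      have := hchar (by omega)
      rw [map_ofNat] at this
      exact CharTwo.of_one_ne_zero_of_two_eq_zero one_ne_zero this
    have hring : ringChar (IsLocalRing.ResidueField A) = 2 := ringChar.eq _ 2
    rcases Nat.eq_zero_or_pos m with rfl | hm0
    · obtain ⟨c, hc⟩ := FiniteField.isSquare_of_char_two hring (IsLocalRing.residue A (u : A))
      obtain ⟨c, rfl⟩ := IsLocalRing.residue_surjective c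
      exact hsq u c (by rw [hc, sq])
    · rw [mem_UL, mem_pow_iff hϖ] at hu
      obtain ⟨a, ha⟩ := hu
      obtain ⟨c, hc⟩ := FiniteField.isSquare_of_char_two hring
        (IsLocalRing.residue A (a * ((ν⁻¹ ^ m : Aˣ) : A)))
      obtain ⟨c, rfl⟩ := IsLocalRing.residue_surjective c
      obtain ⟨v, hv, hv'⟩ := hmul c m hm0
      refine ⟨v, hv, inv_mul_mem_UL ?_⟩
      rw [mem_pow_iff hϖ, NU_coe, hv', hNf]
      obtain ⟨s, hs⟩ := (pow_dvd_pow ϖ (show m + 1 ≤ (m + t + 1) / 2 by omega)).trans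
        ((ht m).1 (π ^ m) dvd_rfl)
      rw [hs]
      rw [← map_mul] at hc
      obtain ⟨r, hr⟩ := res_dvd hϖ hc
      have hνν : ((ν⁻¹ ^ m : Aˣ) : A) * (ν : A) ^ m = 1 := by
        rw [← Units.val_pow_eq_pow_val, ← Units.val_mul, inv_pow, inv_mul_cancel, Units.val_one]
      refine ⟨r * (ν : A) ^ m - c * s, ?_⟩
      linear_combination ha + ϖ ^ m * (ν : A) ^ m * hr - ϖ ^ m * a * hνν
  · intro a ha b hb
    rcases Nat.eq_zero_or_pos t with rfl | ht0
    · have hk : Nat.card (powMonoidHom 2 : (IsLocalRing.ResidueField A)ˣ →* _).ker ≤ 2 := by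
        have hsub : ((powMonoidHom 2 : (IsLocalRing.ResidueField A)ˣ →* _).ker :
            Set (IsLocalRing.ResidueField A)ˣ) ⊆ {1, -1} := by
          intro x hx
          have hx' : x ^ 2 = 1 := hx
          have : (x : IsLocalRing.ResidueField A) * x = 1 := by
            rw [← Units.val_mul, ← sq, hx', Units.val_one]
          rcases mul_self_eq_one_iff.mp this with h | h
          · exact Or.inl (Units.ext h)
          · exact Or.inr (Units.ext (by simpa using h))
        refine (Set.ncard_le_ncard hsub (Set.toFinite _)).trans (Set.ncard_insert_le _ _ |>.trans ?_)
        simp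
      have key : ∀ u : Aˣ, Units.map (IsLocalRing.residue A : A →* _) u ∈
          (powMonoidHom 2 : (IsLocalRing.ResidueField A)ˣ →* _).range →
          ∃ v ∈ UL B 0, (NU A B v)⁻¹ * u ∈ UL A (0 + 1) := by
        rintro u ⟨c, hc⟩
        obtain ⟨c', hc'⟩ := IsLocalRing.residue_surjective (c : IsLocalRing.ResidueField A)
        refine hsq u c' ?_
        rw [hc']
        exact congrArg Units.val hc
      rcases index_two_aux _ hk (Units.map (IsLocalRing.residue A : A →* _) a)
        (Units.map (IsLocalRing.residue A : A →* _) b) with h | h | h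
      · exact Or.inl (key _ h)
      · exact Or.inr (Or.inl (key _ h))
      · rw [← map_inv, ← map_mul] at h
        exact Or.inr (Or.inr (key _ h))
    · obtain ⟨τ, hτ⟩ := (pow_dvd_pow ϖ (show t ≤ (t + t + 1) / 2 by omega)).trans
        ((ht t).1 (π ^ t) dvd_rfl)
      have h20' : (2 : IsLocalRing.ResidueField A) = 0 := by
        have := hchar ht0
        rwa [map_ofNat] at this
      set τ' := IsLocalRing.residue A τ
      set ν' := IsLocalRing.residue A ((ν : A) ^ t) with hν'
      have hν0 : ν' ≠ 0 := by
        rw [hν', Ne, IsLocalRing.residue_eq_zero_iff]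
        exact fun h => h (ν.isUnit.pow t)
      let φ : IsLocalRing.ResidueField A →+ IsLocalRing.ResidueField A :=
        { toFun := fun c => c * τ' + c ^ 2 * ν'
          map_zero' := by simp
          map_add' := fun x y => by linear_combination (x * y * ν') * h20' }
      have hk : Nat.card (AddMonoidHom.toMultiplicative φ).ker ≤ 2 := by
        have hsub : ((AddMonoidHom.toMultiplicative φ).ker :
            Set (Multiplicative (IsLocalRing.ResidueField A))) ⊆
            {Multiplicative.ofAdd 0, Multiplicative.ofAdd (-(τ' / ν'))} := by
          intro x hx
          obtain ⟨x, rfl⟩ := Multiplicative.ofAdd.surjective x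
          have hx' : x * τ' + x ^ 2 * ν' = 0 := hx
          have : x * (τ' + x * ν') = 0 := by rw [← hx']; ring
          rcases mul_eq_zero.1 this with h | h
          · left; rw [h]
          · right
            have : x = -(τ' / ν') := by
              field_simp
              linear_combination h
            rw [this]; rfl
        refine (Set.ncard_le_ncard hsub (Set.toFinite _)).trans (Set.ncard_insert_le _ _ |>.trans ?_)
        simp
      rw [mem_UL, mem_pow_iff hϖ] at ha hb
      obtain ⟨a', ha'⟩ := ha
      obtain ⟨b', hb'⟩ := hb
      have key : ∀ (u : Aˣ) (x : A), ϖ ^ (t + 1) ∣ (u : A) - 1 - ϖ ^ t * x →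
          (Multiplicative.ofAdd (IsLocalRing.residue A x)) ∈
            (AddMonoidHom.toMultiplicative φ).range →
          ∃ v ∈ UL B t, (NU A B v)⁻¹ * u ∈ UL A (t + 1) := by
        rintro u x ⟨z, hz⟩ ⟨c, hc⟩
        obtain ⟨c, rfl⟩ := Multiplicative.ofAdd.surjective c
        have hc' : c * τ' + c ^ 2 * ν' = IsLocalRing.residue A x := hc
        obtain ⟨c, rfl⟩ := IsLocalRing.residue_surjective c
        obtain ⟨v, hv, hv'⟩ := hmul c t ht0
        refine ⟨v, hv, inv_mul_mem_UL ?_⟩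
        rw [mem_pow_iff hϖ, NU_coe, hv', hNf, hτ]
        have : IsLocalRing.residue A x = IsLocalRing.residue A (c * τ + c ^ 2 * (ν : A) ^ t) := by
          rw [← hc']; simp [τ', ν']
        obtain ⟨r, hr⟩ := res_dvd hϖ this
        exact ⟨z + r, by linear_combination hz + ϖ ^ t * hr⟩
      rcases index_two_aux _ hk (Multiplicative.ofAdd (IsLocalRing.residue A a'))
        (Multiplicative.ofAdd (IsLocalRing.residue A b')) with h | h | h
      · exact Or.inl (key a a' ⟨0, by rw [ha']; ring⟩ h)
      · exact Or.inr (Or.inl (key b b' ⟨0, by rw [hb']; ring⟩ h))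
      · rw [← ofAdd_neg, ← ofAdd_add, ← sub_eq_add_neg, ← map_sub] at h
        refine Or.inr (Or.inr (key (a * b⁻¹) (a' - b') ?_ h))
        obtain ⟨n, rfl⟩ : ∃ n, t = n + 1 := ⟨t - 1, by omega⟩
        have hbb : (b : A) * ((b⁻¹ : Aˣ) : A) = 1 := b.mul_inv
        refine ⟨-((b⁻¹ : Aˣ) : A) * (a' - b') * ϖ ^ n * b', ?_⟩
        rw [Units.val_mul]
        linear_combination ((b⁻¹ : Aˣ) : A) * ha' - ((b⁻¹ : Aˣ) : A) * hb' + hbb +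
          (ϖ ^ (n + 1) * (a' - b')) * hbb - ((b⁻¹ : Aˣ) : A) * (ϖ ^ (n + 1) * (a' - b')) * hb'
  · intro m hm u hu
    rw [mem_UL, mem_pow_iff hϖ] at hu
    obtain ⟨a, ha⟩ := hu
    obtain ⟨y, hy, hty⟩ := (ht (2 * m - t)).2
    rw [show (2 * m - t + t + 1) / 2 = m by omega] at hty
    obtain ⟨v, hv⟩ := isUnit_one_add hπ (show 2 * m - t ≠ 0 by omega) (x := algebraMap A B a * y)
      (hy.mul_left _)
    refine ⟨v, ?_, inv_mul_mem_UL ?_⟩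
    · rw [mem_UL, mem_pow_iff hπ, hv, add_sub_cancel_left]
      exact hy.mul_left _
    · rw [mem_pow_iff hϖ, NU_coe, hv, norm_one_add h2, trace_mul, norm_mul' h2, hty]
      obtain ⟨z, hz⟩ := (pow_dvd_pow ϖ (show m + 1 ≤ 2 * m - t by omega)).trans
        (pow_dvd_norm hν hy)
      rw [hz]
      exact ⟨-(a ^ 2 * z), by linear_combination ha⟩
  · intro m hm
    exact hNsub _ _ (by omega) (by omega)

end Ram
end TCF

namespace TCF
section Fin
set_option linter.unusedSectionVars false

theorem padic_solve {p : ℕ} [Fact p.Prime] {A : Type*} [CommRing A] [Algebra ℤ_[p] A]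
    [Module.Free ℤ_[p] A] [Module.Finite ℤ_[p] A] (y : A) :
    ∃ z : A, z ^ 2 + z = (p : A) * y := by
  let b := Module.Free.chooseBasis ℤ_[p] A
  have hdvd : ∀ (n : ℕ) (x : A), (p : A) ^ n ∣ x ↔ ∀ i, (p : ℤ_[p]) ^ n ∣ b.repr x i := by
    intro n x
    constructor
    · rintro ⟨c, rfl⟩ i
      have : (p : A) ^ n * c = ((p : ℤ_[p]) ^ n) • c := by
        rw [Algebra.smul_def, map_pow, map_natCast]
      rw [this]
      simp
    · intro h
      choose c hc using h
      refine ⟨∑ i, c i • b i, ?_⟩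
      have : ∀ c : A, (p : A) ^ n * c = ((p : ℤ_[p]) ^ n) • c := by
        intro c
        rw [Algebra.smul_def, map_pow, map_natCast]
      rw [this, Finset.smul_sum]
      conv_lhs => rw [← b.sum_repr x]
      refine Finset.sum_congr rfl fun i _ => ?_
      rw [hc, mul_smul]
  have hz : ∀ (n : ℕ) (x y : ℤ_[p]),
      x ≡ y [SMOD (IsLocalRing.maximalIdeal ℤ_[p]) ^ n • (⊤ : Submodule ℤ_[p] ℤ_[p])] ↔
      (p : ℤ_[p]) ^ n ∣ x - y := by
    intro n x y
    rw [SModEq.sub_mem, smul_eq_mul, Ideal.mul_top, PadicInt.maximalIdeal_eq_span_p,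
      Ideal.span_singleton_pow, Ideal.mem_span_singleton]
  have hA : ∀ (n : ℕ) (x y : A),
      x ≡ y [SMOD (Ideal.span {(p : A)}) ^ n • (⊤ : Submodule A A)] ↔
      ∀ i, (p : ℤ_[p]) ^ n ∣ b.repr x i - b.repr y i := by
    intro n x y
    rw [SModEq.sub_mem, smul_eq_mul, Ideal.mul_top,
      Ideal.span_singleton_pow, Ideal.mem_span_singleton, hdvd]
    simp
  have hcomp : IsAdicComplete (Ideal.span {(p : A)}) A :=
    { haus' := by
        intro x hx
        apply b.repr.injective
        ext i
        rw [map_zero, Finsupp.zero_apply]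
        refine IsHausdorff.haus (I := IsLocalRing.maximalIdeal ℤ_[p]) inferInstance _ fun n => ?_
        rw [hz]
        simpa using (hA n x 0).1 (hx n) i
      prec' := by
        intro f hf
        have : ∀ i, ∃ L : ℤ_[p], ∀ n, (p : ℤ_[p]) ^ n ∣ b.repr (f n) i - L := by
          intro i
          obtain ⟨L, hL⟩ := IsPrecomplete.prec (I := IsLocalRing.maximalIdeal ℤ_[p])
            inferInstance (f := fun n => b.repr (f n) i) (by
              intro m n hmn
              rw [hz]
              exact (hA _ _ _).1 (hf hmn) i)
          exact ⟨L, fun n => (hz _ _ _).1 (hL n)⟩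
        choose L hL using this
        refine ⟨∑ i, L i • b i, fun n => (hA _ _ _).2 fun i => ?_⟩
        rw [b.repr_sum_self]
        exact hL i n }
  obtain ⟨z, hz, -⟩ := HenselianRing.is_henselian (I := Ideal.span {(p : A)})
    (Polynomial.X ^ 2 + Polynomial.X - Polynomial.C ((p : A) * y)) (by
      monicity!) 0 (by
      simp only [Polynomial.eval_sub, Polynomial.eval_add, Polynomial.eval_pow, Polynomial.eval_X,
        Polynomial.eval_C]
      rw [Ideal.mem_span_singleton]
      exact ⟨-y, by ring⟩) (by simp)
  refine ⟨z, ?_⟩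
  have := hz
  simp only [Polynomial.IsRoot, Polynomial.eval_sub, Polynomial.eval_add, Polynomial.eval_pow,
    Polynomial.eval_X, Polynomial.eval_C] at this
  linear_combination this

variable {A B : Type*} [CommRing A] [CommRing B] [Algebra A B] [Module.Free A B]
  [Module.Finite A B]
variable [IsDomain A] [IsDomain B] [IsDiscreteValuationRing A] [IsDiscreteValuationRing B]

theorem efdeg (h2 : Module.finrank A B = 2) [Finite (IsLocalRing.ResidueField A)] (f : ℕ)
    (hf : Nat.card (IsLocalRing.ResidueField B) = Nat.card (IsLocalRing.ResidueField A) ^ f)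
    {ϖ : A} (hϖ : Irreducible ϖ) {π : B} (hπ : Irreducible π) :
    ∃ (e : ℕ) (w : Bˣ), algebraMap A B ϖ = w * π ^ e ∧ f * e = 2 := by
  have hinj : Function.Injective (algebraMap A B) := FaithfulSMul.algebraMap_injective A B
  have hne : algebraMap A B ϖ ≠ 0 := by
    rw [Ne, map_eq_zero_iff _ hinj]; exact hϖ.ne_zero
  obtain ⟨e, w, hw⟩ := IsDiscreteValuationRing.eq_unit_mul_pow_irreducible hne hπ
  refine ⟨e, w, hw, ?_⟩
  have hI : Ideal.map (algebraMap A B) (IsLocalRing.maximalIdeal A) =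
      IsLocalRing.maximalIdeal B ^ e := by
    rw [hϖ.maximalIdeal_eq, Ideal.map_span, Set.image_singleton, hw, hπ.maximalIdeal_eq,
      Ideal.span_singleton_pow]
    exact Ideal.span_singleton_mul_left_unit w.isUnit _
  have hbot : IsLocalRing.maximalIdeal B ≠ ⊥ := IsDiscreteValuationRing.not_a_field B
  have hc := cardQuot_pow_of_prime (P := IsLocalRing.maximalIdeal B) hbot (i := e)
  rw [← hI, Submodule.cardQuot_apply, Submodule.cardQuot_apply] at hc
  let i1 := Ideal.Quotient.field (IsLocalRing.maximalIdeal A)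
  have hfin : Module.Finite (A ⧸ IsLocalRing.maximalIdeal A)
      (B ⧸ (Ideal.map (algebraMap A B) (IsLocalRing.maximalIdeal A))) :=
    Module.Finite.of_basis (IsLocalRing.basisQuotient (Module.Free.chooseBasis A B))
  have hr : Module.finrank (A ⧸ IsLocalRing.maximalIdeal A)
      (B ⧸ (Ideal.map (algebraMap A B) (IsLocalRing.maximalIdeal A))) = 2 := by
    rw [Module.finrank_eq_card_basis (IsLocalRing.basisQuotient (Module.Free.chooseBasis A B)),
      ← Module.finrank_eq_card_chooseBasisIndex, h2]
  have hc2 := Module.natCard_eq_pow_finrank (K := A ⧸ IsLocalRing.maximalIdeal A)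
      (V := B ⧸ (Ideal.map (algebraMap A B) (IsLocalRing.maximalIdeal A)))
  rw [hr] at hc2
  have hq : 1 < Nat.card (IsLocalRing.ResidueField A) := Finite.one_lt_card
  have h3 : Nat.card (IsLocalRing.ResidueField A) ^ (f * e) =
      Nat.card (IsLocalRing.ResidueField A) ^ 2 := by
    rw [pow_mul, ← hf]
    exact hc.symm.trans hc2
  exact Nat.pow_right_injective hq h3

theorem abs_main (h2 : Module.finrank A B = 2) (h20 : (2 : A) ≠ 0)
    [Finite (IsLocalRing.ResidueField A)] (f : ℕ)
    (hf : Nat.card (IsLocalRing.ResidueField B) = Nat.card (IsLocalRing.ResidueField A) ^ f)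
    (hsq : ∃ n, ∀ x ∈ IsLocalRing.maximalIdeal A ^ n, ∃ z : A, 1 + x = z ^ 2)
    {F K : Type*} [Field F] [Field K] [Algebra A F] [IsFractionRing A F] [Algebra B K]
    [FaithfulSMul B K]
    [Algebra F K] (hnorm : ∀ b : B, Algebra.norm F (algebraMap B K b) =
      algebraMap A F (Algebra.norm A b))
    {k : Type*} [Field k]
    (ω : Fˣ →* kˣ) (hω_ne : ω ≠ 1)
    (hω_norm : ∀ z : Kˣ, ω (Units.map (Algebra.norm F (S := K)) z) = 1)
    (χ : Fˣ →* kˣ)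
    (hχ : ∃ i, ∀ u ∈ UL A i, χ.comp (Units.map (algebraMap A F : A →* F)) u = 1) :
    f * cnd (UL B) ((χ.comp (Units.map (Algebra.norm F (S := K)))).comp
        (Units.map (algebraMap B K : B →* K))) +
      cnd (UL A) (ω.comp (Units.map (algebraMap A F : A →* F))) =
    cnd (UL A) (χ.comp (Units.map (algebraMap A F : A →* F))) +
      cnd (UL A) ((χ * ω).comp (Units.map (algebraMap A F : A →* F))) := by
  obtain ⟨ϖ, hϖ⟩ := IsDiscreteValuationRing.exists_irreducible A
  obtain ⟨π, hπ⟩ := IsDiscreteValuationRing.exists_irreducible B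
  obtain ⟨e, w, hw, hfe⟩ := efdeg h2 f hf hϖ hπ
  have hcomm : (Units.map (Algebra.norm F (S := K))).comp (Units.map (algebraMap B K : B →* K)) =
      (Units.map (algebraMap A F : A →* F)).comp (NU A B) := by
    ext v
    exact hnorm v
  have hω' : ∀ v, ω.comp (Units.map (algebraMap A F : A →* F)) (NU A B v) = 1 := by
    intro v
    have := hω_norm (Units.map (algebraMap B K : B →* K) v)
    rwa [← MonoidHom.comp_apply (Units.map (Algebra.norm F (S := K))), hcomm] at this
  have hωf : ∃ i, ∀ u ∈ UL A i, ω.comp (Units.map (algebraMap A F : A →* F)) u = 1 := by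
    obtain ⟨n, hn⟩ := hsq
    refine ⟨n, fun u hu => ?_⟩
    obtain ⟨z, hz⟩ := hn _ hu
    rw [add_sub_cancel] at hz
    have hzu : IsUnit z := by
      rw [← isUnit_pow_iff two_ne_zero, ← hz]; exact u.isUnit
    obtain ⟨z, rfl⟩ := hzu
    have := hω' (Units.map (algebraMap A B : A →* B) z)
    have e : NU A B (Units.map (algebraMap A B : A →* B) z) = u := by
      ext
      rw [NU_coe, hz]
      exact norm_alg h2 _
    rwa [e] at this
  rw [MonoidHom.comp_assoc, hcomm, ← MonoidHom.comp_assoc, MonoidHom.mul_comp]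
  have hcases : (f = 2 ∧ e = 1) ∨ (f = 1 ∧ e = 2) := by
    have : f ≤ 2 := Nat.le_of_dvd two_pos ⟨e, hfe.symm⟩
    interval_cases f <;> omega
  rcases hcases with ⟨rfl, rfl⟩ | ⟨rfl, rfl⟩
  · refine unram_main h2 hϖ ?_ _ _ hω' hωf hχ
    rw [hw, pow_one, irreducible_units_mul]
    exact hπ
  · rw [one_mul]
    refine ram_main h2 h20 hϖ hπ hw _ _ ?_ hω' hωf hχ
    intro h1
    apply hω_ne
    obtain ⟨ν, hν⟩ := norm_unif h2 hϖ hw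
    have hunit : ∀ (x : Fˣ) (u : Aˣ), (x : F) = algebraMap A F u → ω x = 1 := by
      intro x u h
      have : x = Units.map (algebraMap A F : A →* F) u := by ext; exact h
      rw [this, ← MonoidHom.comp_apply, h1, MonoidHom.one_apply]
    have hinjB := FaithfulSMul.algebraMap_injective B K
    have hinjA := IsFractionRing.injective A F
    have hϖF : algebraMap A F ϖ ≠ 0 := by
      rw [Ne, map_eq_zero_iff _ hinjA]; exact hϖ.ne_zero
    have hπK : algebraMap B K π ≠ 0 := by
      rw [Ne, map_eq_zero_iff _ hinjB]; exact hπ.ne_zero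
    have hωϖ : ω (Units.mk0 _ hϖF) = 1 := by
      have e1 := hω_norm (Units.mk0 _ hπK)
      have e2 : Units.map (Algebra.norm F (S := K)) (Units.mk0 _ hπK) =
          Units.mk0 _ hϖF * Units.map (algebraMap A F : A →* F) ν := by
        ext
        simp [hnorm, hν]
      rw [e2, map_mul, hunit (Units.map (algebraMap A F : A →* F) ν) ν rfl, mul_one] at e1
      exact e1
    have hall : ∀ (a : A) (x : Fˣ), (x : F) = algebraMap A F a → ω x = 1 := by
      intro a x hx
      have ha : a ≠ 0 := by
        rintro rfl
        exact x.ne_zero (by rw [hx, map_zero])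
      obtain ⟨n, u, hu⟩ := IsDiscreteValuationRing.eq_unit_mul_pow_irreducible ha hϖ
      have : x = Units.map (algebraMap A F : A →* F) u * (Units.mk0 _ hϖF) ^ n := by
        ext
        simp [hx, hu]
      rw [this, map_mul, map_pow, hωϖ, hunit _ u rfl, one_pow, one_mul]
    ext1 x
    obtain ⟨a, b, hb, hab⟩ := IsFractionRing.div_surjective (A := A) (x : F)
    have hb0 : algebraMap A F b ≠ 0 := by
      rw [Ne, map_eq_zero_iff _ hinjA]; exact nonZeroDivisors.ne_zero hb
    have e1 : ω (x * Units.mk0 _ hb0) = 1 := by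
      refine hall a _ ?_
      simp [← hab, hb0]
    rw [map_mul, hall b (Units.mk0 _ hb0) rfl, mul_one] at e1
    exact e1

end Fin
end TCF

namespace TCF
section Asm
open IsLocalRing

theorem padic_facts {p : ℕ} [Fact p.Prime] {F : Type*} [Field F] [Algebra ℚ_[p] F]
    [FiniteDimensional ℚ_[p] F] [Algebra ℤ_[p] F] [IsScalarTower ℤ_[p] ℚ_[p] F]
    (A : Type*) [CommRing A] [IsDomain A] [IsLocalRing A] [Algebra ℤ_[p] A] [Algebra A F]
    [IsScalarTower ℤ_[p] A F] [IsIntegralClosure A ℤ_[p] F] :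
    IsDiscreteValuationRing A ∧ Module.Finite ℤ_[p] A ∧ Module.Free ℤ_[p] A ∧
      IsFractionRing A F ∧ Finite (ResidueField A) ∧ CharZero A := by
  have hcF : CharZero F := charZero_of_injective_algebraMap (algebraMap ℚ_[p] F).injective
  have hded := IsIntegralClosure.isDedekindDomain ℤ_[p] ℚ_[p] F A
  have hfin := IsIntegralClosure.finite ℤ_[p] ℚ_[p] F A
  have hfr := IsIntegralClosure.isFractionRing_of_finite_extension ℤ_[p] ℚ_[p] F A
  have htF : Module.IsTorsionFree ℤ_[p] F := .trans_faithfulSMul ℤ_[p] ℚ_[p] F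
  have htA : Module.IsTorsionFree ℤ_[p] A := IsIntegralClosure.isTorsionFree ℤ_[p] F
  have hfree := IsIntegralClosure.module_free ℤ_[p] ℚ_[p] F A
  have hint : Algebra.IsIntegral ℤ_[p] A := IsIntegralClosure.isIntegral_algebra ℤ_[p] F
  have hinj : Function.Injective (algebraMap ℤ_[p] A) := FaithfulSMul.algebraMap_injective _ _
  have hcA : CharZero A := charZero_of_injective_algebraMap hinj
  have hnf : ¬ IsField A := by
    intro h
    have := (Algebra.IsIntegral.isField_iff_isField (R := ℤ_[p]) (S := A) hinj).2 h
    exact IsDiscreteValuationRing.not_isField ℤ_[p] this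
  have hdvr : IsDiscreteValuationRing A := ((IsDiscreteValuationRing.TFAE A hnf).out 0 2).2 hded
  have : Finite (ResidueField ℤ_[p]) :=
    Finite.of_equiv (ZMod p) (PadicInt.residueField (p := p)).symm.toEquiv
  have hres : Finite (ResidueField A) := ResidueField.finite_of_finite (R := ℤ_[p]) this
  exact ⟨hdvr, hfin, hfree, hfr, hres, hcA⟩

theorem sq_near_one {p : ℕ} [Fact p.Prime] {A : Type*} [CommRing A] [IsDomain A]
    [IsDiscreteValuationRing A] [Algebra ℤ_[p] A] [Module.Free ℤ_[p] A] [Module.Finite ℤ_[p] A]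
    [CharZero A] : ∃ n, ∀ x ∈ maximalIdeal A ^ n, ∃ z : A, 1 + x = z ^ 2 := by
  obtain ⟨ϖ, hϖ⟩ := IsDiscreteValuationRing.exists_irreducible A
  have h4 : (4 * (p : A)) ≠ 0 := by
    have : (p : A) ≠ 0 := Nat.cast_ne_zero.2 (Fact.out : p.Prime).ne_zero
    exact mul_ne_zero (by norm_num) this
  obtain ⟨n, u, hu⟩ := IsDiscreteValuationRing.eq_unit_mul_pow_irreducible h4 hϖ
  refine ⟨n, fun x hx => ?_⟩
  rw [hϖ.maximalIdeal_eq, Ideal.span_singleton_pow, Ideal.mem_span_singleton] at hx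
  obtain ⟨c, hc⟩ := hx
  obtain ⟨z, hz⟩ := padic_solve (p := p) ((↑u⁻¹ : A) * c)
  refine ⟨1 + 2 * z, ?_⟩
  have h1 : x = 4 * (p : A) * ((↑u⁻¹ : A) * c) := by
    rw [hu, hc]
    have : (u : A) * (↑u⁻¹ : A) = 1 := u.mul_inv
    linear_combination (-(ϖ ^ n * c)) * this
  rw [h1]
  linear_combination (-4) * hz

theorem padic_main {p : ℕ} [Fact p.Prime]
    {F : Type*} [Field F] [Algebra ℚ_[p] F] [FiniteDimensional ℚ_[p] F]
    [Algebra ℤ_[p] F] [IsScalarTower ℤ_[p] ℚ_[p] F]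
    {K : Type*} [Field K] [Algebra ℚ_[p] K] [Algebra ℤ_[p] K]
    [IsScalarTower ℤ_[p] ℚ_[p] K]
    [Algebra F K] [IsScalarTower ℚ_[p] F K] [IsScalarTower ℤ_[p] F K]
    (A B : Type*) [CommRing A] [IsDomain A] [IsLocalRing A] [Algebra ℤ_[p] A] [Algebra A F]
    [IsScalarTower ℤ_[p] A F] [IsIntegralClosure A ℤ_[p] F]
    [CommRing B] [IsDomain B] [IsLocalRing B] [Algebra ℤ_[p] B] [Algebra B K]
    [IsScalarTower ℤ_[p] B K] [IsIntegralClosure B ℤ_[p] K]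
    (g : A →+* B) (hg : ∀ a, algebraMap B K (g a) = algebraMap F K (algebraMap A F a))
    (hquad : Module.finrank F K = 2)
    {k : Type*} [Field k]
    (ω : Fˣ →* kˣ) (hω_ne : ω ≠ 1)
    (hω_norm : ∀ z : Kˣ, ω (Units.map (Algebra.norm F (S := K)) z) = 1)
    (f : ℕ) (hf : Nat.card (ResidueField B) = Nat.card (ResidueField A) ^ f)
    (χ : Fˣ →* kˣ)
    (hχ : ∃ i, ∀ u ∈ UL A i, χ.comp (Units.map (algebraMap A F : A →* F)) u = 1) :
    f * cnd (UL B) ((χ.comp (Units.map (Algebra.norm F (S := K)))).comp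
        (Units.map (algebraMap B K : B →* K))) +
      cnd (UL A) (ω.comp (Units.map (algebraMap A F : A →* F))) =
    cnd (UL A) (χ.comp (Units.map (algebraMap A F : A →* F))) +
      cnd (UL A) ((χ * ω).comp (Units.map (algebraMap A F : A →* F))) := by
  have : FiniteDimensional F K := Module.finite_of_finrank_pos (by omega)
  have : FiniteDimensional ℚ_[p] K := FiniteDimensional.trans ℚ_[p] F K
  obtain ⟨_, _, _, _, _, _⟩ := padic_facts (p := p) (F := F) A
  obtain ⟨_, _, _, _, _, _⟩ := padic_facts (p := p) (F := K) B
  have hcF : CharZero F := charZero_of_injective_algebraMap (algebraMap ℚ_[p] F).injective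
  letI : Algebra A B := g.toAlgebra
  letI : Algebra A K := ((algebraMap F K).comp (algebraMap A F)).toAlgebra
  have : IsScalarTower A F K := IsScalarTower.of_algebraMap_eq fun _ => rfl
  have : IsScalarTower A B K := IsScalarTower.of_algebraMap_eq fun a => (hg a).symm
  have : IsScalarTower ℤ_[p] A K := IsScalarTower.of_algebraMap_eq fun a => by
    rw [IsScalarTower.algebraMap_apply A F K, ← IsScalarTower.algebraMap_apply ℤ_[p] A F,
      ← IsScalarTower.algebraMap_apply ℤ_[p] F K]
  have hBK : Function.Injective (algebraMap B K) := IsFractionRing.injective B K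
  have : IsScalarTower ℤ_[p] A B := IsScalarTower.of_algebraMap_eq fun a => hBK <| by
    rw [← IsScalarTower.algebraMap_apply A B K, ← IsScalarTower.algebraMap_apply ℤ_[p] A K,
      ← IsScalarTower.algebraMap_apply ℤ_[p] B K]
  have : Algebra.IsIntegral ℤ_[p] A := IsIntegralClosure.isIntegral_algebra ℤ_[p] F
  have : IsIntegralClosure B A K := IsIntegralClosure.tower_top (R := ℤ_[p])
  have : Module.Finite A B := Module.Finite.of_restrictScalars_finite ℤ_[p] A B
  have : Module.IsTorsionFree A K := .trans_faithfulSMul A F K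
  have : Module.Free A B := IsIntegralClosure.module_free A F K B
  have h2 : Module.finrank A B = 2 := (IsIntegralClosure.rank A F K B).trans hquad
  have hloc := IsIntegralClosure.isLocalization A F K B
  exact abs_main h2 (by norm_num) f hf (sq_near_one (p := p))
    (fun b => Algebra.norm_localization A (nonZeroDivisors A) b) ω hω_ne hω_norm χ hχ

end Asm
end TCF


theorem TCF.level_iff (χ : Lˣ →* ℂˣ) (i : ℕ) :
    (∀ u ∈ unitLevelSet p L i, χ u = 1) ↔
      ∀ u ∈ TCF.UL (integralClosure ℤ_[p] L) i,
        χ.comp (Units.map (algebraMap (integralClosure ℤ_[p] L) L :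
          integralClosure ℤ_[p] L →* L)) u = 1 := by
  constructor
  · intro h v hv
    refine h _ ?_
    unfold unitLevelSet
    split_ifs with hi
    · exact ⟨v, rfl⟩
    · refine ⟨(v : integralClosure ℤ_[p] L) - 1, hv, ?_⟩
      have h1 : ((Units.map (algebraMap (integralClosure ℤ_[p] L) L :
          integralClosure ℤ_[p] L →* L) v : Lˣ) : L) =
          ((v : integralClosure ℤ_[p] L) : L) := rfl
      rw [h1]
      push_cast
      ring
  · intro h u hu
    unfold unitLevelSet at hu
    split_ifs at hu with hi
    · obtain ⟨v, hv⟩ := hu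
      have h1 : u = Units.map (algebraMap (integralClosure ℤ_[p] L) L :
          integralClosure ℤ_[p] L →* L) v := Units.ext hv.symm
      rw [h1]
      refine h v ?_
      subst hi
      rw [TCF.mem_UL]
      simp
    · obtain ⟨m, hm, hum⟩ := hu
      have hm1 : m ∈ IsLocalRing.maximalIdeal (integralClosure ℤ_[p] L) :=
        Ideal.pow_le_self hi hm
      have hun : IsUnit (1 + m) := by
        by_contra hn
        have h2 : (1 + m) ∈ IsLocalRing.maximalIdeal (integralClosure ℤ_[p] L) := hn
        have h3 := Ideal.sub_mem _ h2 hm1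
        rw [add_sub_cancel_right] at h3
        exact (Ideal.ne_top_iff_one _).1 (IsLocalRing.maximalIdeal.isMaximal _).ne_top h3
      obtain ⟨v, hv⟩ := hun
      have h1 : u = Units.map (algebraMap (integralClosure ℤ_[p] L) L :
          integralClosure ℤ_[p] L →* L) v := by
        refine Units.ext ?_
        have h4 : ((Units.map (algebraMap (integralClosure ℤ_[p] L) L :
          integralClosure ℤ_[p] L →* L) v : Lˣ) : L) =
          ((v : integralClosure ℤ_[p] L) : L) := rfl
        rw [h4, hv, hum]
        push_cast
        rfl
      rw [h1]
      refine h v ?_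
      rw [TCF.mem_UL, hv, add_sub_cancel_left]
      exact hm

theorem TCF.conductor_eq (χ : Lˣ →* ℂˣ) :
    charConductor p χ = TCF.cnd (TCF.UL (integralClosure ℤ_[p] L))
      (χ.comp (Units.map (algebraMap (integralClosure ℤ_[p] L) L :
          integralClosure ℤ_[p] L →* L))) := by
  unfold charConductor TCF.cnd
  congr 1
  ext i
  exact TCF.level_iff p χ i

/-- **Tunnell's conductor formula.** Let `p` be a prime, `F` a finite
extension of `ℚ_p`, and `K` a quadratic extension of `F`. Let `ω_{K/F}` be a
multiplicative character of `F^×` that is nontrivial and trivial on the norm group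
`N_{K/F}(K^×)`, and let `f = f_{K/F}` be the residue degree of `K/F` (so that the
residue field of `O_K` has cardinality that of `O_F` raised to the `f`-th power). Then
for every multiplicative character `χ` of `F^×` of finite conductor,
`f_{K/F} · c(χ ∘ N_{K/F}) = c(χ) + c(χ·ω_{K/F}) − c(ω_{K/F})`. -/
theorem tunnell_conductor_formula
    {p : ℕ} [Fact p.Prime]
    {F : Type*} [Field F] [Algebra ℚ_[p] F] [FiniteDimensional ℚ_[p] F]
    [Algebra ℤ_[p] F] [IsScalarTower ℤ_[p] ℚ_[p] F]
    [IsLocalRing (integralClosure ℤ_[p] F)]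
    {K : Type*} [Field K] [Algebra ℚ_[p] K] [Algebra ℤ_[p] K]
    [IsScalarTower ℤ_[p] ℚ_[p] K] [IsLocalRing (integralClosure ℤ_[p] K)]
    [Algebra F K] [IsScalarTower ℚ_[p] F K] [IsScalarTower ℤ_[p] F K]
    (hquad : Module.finrank F K = 2)
    (ω : Fˣ →* ℂˣ) (hω_ne : ω ≠ 1)
    (hω_norm : ∀ z : Kˣ, ω (Units.map (Algebra.norm F (S := K)) z) = 1)
    (f : ℕ)
    (hf : Nat.card (IsLocalRing.ResidueField (integralClosure ℤ_[p] K))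
      = Nat.card (IsLocalRing.ResidueField (integralClosure ℤ_[p] F)) ^ f)
    (χ : Fˣ →* ℂˣ) (hχ : CharHasFiniteConductor p χ) :
    (f : ℤ) * charConductor p (χ.comp (Units.map (Algebra.norm F (S := K))))
      = (charConductor p χ : ℤ) + (charConductor p (χ * ω) : ℤ)
          - (charConductor p ω : ℤ) := by
  have h := TCF.padic_main (p := p) (F := F) (K := K)
    (integralClosure ℤ_[p] F) (integralClosure ℤ_[p] K)
    ((IsScalarTower.toAlgHom ℤ_[p] F K).mapIntegralClosure : _ →+* _) (fun _ => rfl)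
    hquad ω hω_ne hω_norm f hf χ (by
      obtain ⟨i, hi⟩ := hχ
      exact ⟨i, (TCF.level_iff p χ i).1 hi⟩)
  rw [← TCF.conductor_eq, ← TCF.conductor_eq, ← TCF.conductor_eq, ← TCF.conductor_eq] at h
  have h' : ((f * charConductor p (χ.comp (Units.map (Algebra.norm F (S := K)))) +
    charConductor p ω : ℕ) : ℤ) = ((charConductor p χ + charConductor p (χ * ω) : ℕ) : ℤ) :=
    congrArg _ h
  push_cast at h'
  linarith

end
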